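/- Let (A,≡_A) be an equivalence family and er(A) its causal unfolding, with counit map ε_A : (C(er(A)),≡_P) → (A,≡_A) given by ε_A(p) = max(p), a map of equivalence families. For every ese Q and every map of equivalence families f : (C(Q),≡_Q) → (A,≡_A) there is a map of ese's h : Q → er(A) such that f = ε_A ∘ h. Moreover, if h' : Q → er(A) is a map of ese's such that f ≡ ε_A ∘ h', then h' ≡ h. -/

import Mathlib

universe u v w

/-- The image of a set under a partial function. -/
def pimage {α : Type u} {β : Type v} (f : α → Option β) (x : Set α) : Set β :=
  {b | ∃ a ∈ x, f a = some b}

/-- A family of configurations over the set of events `A`: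
a non-empty family of subsets, whose underlying set is all of `A`,
closed under unions of finitely compatible subfamilies,
and satisfying the securing-chain condition. -/
structure ConfigFamily (A : Type u) where
  F : Set (Set A)
  nonempty : F.Nonempty
  covers : ∀ a : A, ∃ x ∈ F, a ∈ x
  unionClosed : ∀ X ⊆ F, (∀ Y ⊆ X, Y.Finite → ∃ z ∈ F, ∀ y ∈ Y, y ⊆ z) → ⋃₀ X ∈ F
  secured : ∀ x ∈ F, ∀ e ∈ x, ∃ l : List A, l ≠ [] ∧ l.getLast? = some e ∧
    (∀ a ∈ l, a ∈ x) ∧ ∀ i, 0 < i → i ≤ l.length → {a | a ∈ l.take i} ∈ F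

/-- A causal realisation of the family `C`: a partial order whose
principal lower sets are finite, together with a function to events
sending every down-closed subset to a configuration of the family. -/
structure Realisation {A : Type u} (C : ConfigFamily A) where
  carrier : Type u
  le : carrier → carrier → Prop
  le_refl : ∀ a, le a a
  le_trans : ∀ a b c, le a b → le b c → le a c
  le_antisymm : ∀ a b, le a b → le b a → a = b
  finPast : ∀ e, {e' | le e' e}.Finite
  ρ : carrier → A
  real : ∀ x : Set carrier, (∀ a ∈ x, ∀ b, le b a → b ∈ x) → ρ '' x ∈ C.F

namespace Realisation

variable {A : Type u} {C : ConfigFamily A}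

/-- Down-closed subsets of the carrier of a realisation. -/
def IsDown (r : Realisation C) (x : Set r.carrier) : Prop :=
  ∀ a ∈ x, ∀ b, r.le b a → b ∈ x

/-- The set `[a) = [a] \ {a}` of strict predecessors. -/
def spred (r : Realisation C) (a : r.carrier) : Set r.carrier :=
  {b | r.le b a ∧ b ≠ a}

/-- The carrier has a top element. -/
def HasTop (r : Realisation C) : Prop := ∃ t, ∀ a, r.le a t

end Realisation

/-- A map of realisations: a partial surjective function between the carriers,
preserving down-closed subsets and commuting with the functions to events. -/
structure RealMap {A : Type u} {C : ConfigFamily A} (r r' : Realisation C) where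
  f : r.carrier → Option r'.carrier
  surj : ∀ b, ∃ a, f a = some b
  presDown : ∀ x, r.IsDown x → r'.IsDown (pimage f x)
  commutes : ∀ a b, f a = some b → r.ρ a = r'.ρ b

namespace RealMap

variable {A : Type u} {C : ConfigFamily A} {r r' r₀ : Realisation C}

/-- The map is total. -/
def IsTotal (m : RealMap r r') : Prop := ∀ a, ∃ b, m.f a = some b

/-- The map is an isomorphism of realisations: it has an inverse map of
realisations, given by the inverse relation. -/
def IsIso (m : RealMap r r') : Prop :=
  ∃ m' : RealMap r' r, ∀ a b, m.f a = some b ↔ m'.f b = some a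

/-- `m : r → r₀` is a projection witnessed by `g`: `g` realises the carrier of
`r₀` as a subset of the carrier of `r` with the restricted order and restricted
function to events, and `m` is the inverse relation of this inclusion. -/
def IsProjectionVia (m : RealMap r r₀) (g : r₀.carrier → r.carrier) : Prop :=
  Function.Injective g ∧ (∀ a b, r₀.le a b ↔ r.le (g a) (g b)) ∧
    (∀ a, r₀.ρ a = r.ρ (g a)) ∧ (∀ a b, m.f a = some b ↔ g b = a)

/-- `m` is a projection. -/
def IsProjection (m : RealMap r r₀) : Prop := ∃ g, m.IsProjectionVia g

end RealMap

/-- A realisation is extremal when every total map of realisations from it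
is an isomorphism. -/
def Realisation.Extremal {A : Type u} {C : ConfigFamily A} (r : Realisation C) : Prop :=
  ∀ (r' : Realisation C) (m : RealMap r r'), m.IsTotal → m.IsIso

/-- A prime extremal realisation: extremal with a top element. -/
def Realisation.PrimeExtremal {A : Type u} {C : ConfigFamily A} (r : Realisation C) : Prop :=
  r.Extremal ∧ r.HasTop

/-- Isomorphism of realisations. -/
def RealIso {A : Type u} {C : ConfigFamily A} (r r' : Realisation C) : Prop :=
  ∃ m : RealMap r r', m.IsIso

/-- `m` is the composite of `m₁` followed by `m₂` (as partial functions). -/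
def CompEq {A : Type u} {C : ConfigFamily A} {r r' r'' : Realisation C}
    (m₁ : RealMap r r') (m₂ : RealMap r' r'') (m : RealMap r r'') : Prop :=
  ∀ a c, m.f a = some c ↔ ∃ b, m₁.f a = some b ∧ m₂.f b = some c

/-- Down-closed subsets w.r.t. a causal dependency relation. -/
def DnClosed {P : Type u} (le : P → P → Prop) (x : Set P) : Prop :=
  ∀ a ∈ x, ∀ b, le b a → b ∈ x

/-- Configurations of a (prime) event structure: down-closed subsets all of
whose finite subsets are consistent. -/
def IsCfg {P : Type u} (le : P → P → Prop) (Con : Set (Set P)) (x : Set P) : Prop :=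
  DnClosed le x ∧ ∀ X ⊆ x, X.Finite → X ∈ Con

/-- The set `[p) = [p] \ {p}` of strict causal predecessors. -/
def strictPred {P : Type u} (le : P → P → Prop) (p : P) : Set P :=
  {p' | le p' p ∧ p' ≠ p}

/-- The data of a prime event structure with equivalence (ese). -/
structure ESEData (P : Type u) where
  le : P → P → Prop
  Con : Set (Set P)
  eqv : P → P → Prop

/-- The axioms of a prime event structure with equivalence. -/
structure IsESE {P : Type u} (D : ESEData P) : Prop where
  le_refl : ∀ a, D.le a a
  le_trans : ∀ a b c, D.le a b → D.le b c → D.le a c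
  le_antisymm : ∀ a b, D.le a b → D.le b a → a = b
  finCause : ∀ e, {e' | D.le e' e}.Finite
  con_fin : ∀ X ∈ D.Con, X.Finite
  con_single : ∀ e, ({e} : Set P) ∈ D.Con
  con_mono : ∀ X Y, X ⊆ Y → Y ∈ D.Con → X ∈ D.Con
  con_le : ∀ X ∈ D.Con, ∀ e e', D.le e e' → e' ∈ X → X ∪ {e} ∈ D.Con
  eqv_equiv : Equivalence D.eqv

/-- The configurations of an ese. -/
def Cfgs {P : Type u} (D : ESEData P) : Set (Set P) := {x | IsCfg D.le D.Con x}

/-- A partial function preserves the equivalences: equivalent elements are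
either both sent to nothing, or both to defined, equivalent results. -/
def PreservesEqv {α : Type u} {β : Type v} (eA : α → α → Prop) (eB : β → β → Prop)
    (f : α → Option β) : Prop :=
  ∀ a₁ a₂, eA a₁ a₂ → (f a₁ = none ∧ f a₂ = none) ∨
    ∃ b₁ b₂, f a₁ = some b₁ ∧ f a₂ = some b₂ ∧ eB b₁ b₂

/-- A map of equivalence families (given by their families of configurations
and equivalences): a partial function which preserves the equivalence, sends
configurations to configurations, and locally reflects the equivalence. -/
def IsEFMap {α : Type u} {β : Type v} (FA : Set (Set α)) (eA : α → α → Prop)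
    (FB : Set (Set β)) (eB : β → β → Prop) (f : α → Option β) : Prop :=
  PreservesEqv eA eB f ∧ ∀ x ∈ FA, pimage f x ∈ FB ∧
    ∀ a₁ ∈ x, ∀ a₂ ∈ x, ∀ b₁ b₂, f a₁ = some b₁ → f a₂ = some b₂ → eB b₁ b₂ → eA a₁ a₂

/-- A map of ese's: a map of equivalence families between the families of
configurations with their equivalences. -/
def IsESEMap {P : Type u} {Q : Type v} (DP : ESEData P) (DQ : ESEData Q)
    (f : P → Option Q) : Prop :=
  IsEFMap (Cfgs DP) DP.eqv (Cfgs DQ) DQ.eqv f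

/-- Equivalence of partial maps: equidefined with equivalent results. -/
def MapEqv {α : Type u} {β : Type v} (eB : β → β → Prop) (f g : α → Option β) : Prop :=
  ∀ a, (f a = none ∧ g a = none) ∨ ∃ b₁ b₂, f a = some b₁ ∧ g a = some b₂ ∧ eB b₁ b₂

/-- The causal dependency of the causal unfolding: `p' ≤ p` iff there is a map
of realisations from `p` to `p'`. -/
def erLe {A : Type u} {C : ConfigFamily A} (P : Set (Realisation C)) (p' p : ↥P) : Prop :=
  Nonempty (RealMap p.val p'.val)

/-- `P` is a choice of one prime extremal realisation from each isomorphism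
class of prime extremal realisations of the family. -/
def erChoice {A : Type u} {C : ConfigFamily A} (P : Set (Realisation C)) : Prop :=
  (∀ p ∈ P, Realisation.PrimeExtremal p) ∧
  ∀ r : Realisation C, r.PrimeExtremal → ∃! p, p ∈ P ∧ RealIso p r

/-- `mx` sends each chosen prime extremal realisation to the image of its top
element. -/
def erMax {A : Type u} {C : ConfigFamily A} {P : Set (Realisation C)} (mx : ↥P → A) : Prop :=
  ∀ p : ↥P, ∃ t : p.val.carrier, (∀ a, p.val.le a t) ∧ mx p = p.val.ρ t

/-- The causal unfolding `er(A)` of an equivalence family, as an ese on the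
chosen prime extremal realisations `P`: causal dependency is `erLe`; a finite
set is consistent when the image under `mx` of its down-closure is a
configuration; two primes are equivalent when their tops are. -/
def erData {A : Type u} {C : ConfigFamily A} (P : Set (Realisation C))
    (eqA : A → A → Prop) (mx : ↥P → A) : ESEData ↥P where
  le := erLe P
  Con := {X | X.Finite ∧ mx '' {p | ∃ q ∈ X, erLe P p q} ∈ C.F}
  eqv := fun p₁ p₂ => eqA (mx p₁) (mx p₂)

section CausalUnfolding

variable {A : Type u} {C : ConfigFamily A}

/-- A subfamily of configurations bounded by a configuration has its union in the family. -/
theorem ConfigFamily.sUnion_mem_of_bounded (C : ConfigFamily A) {X : Set (Set A)} {z : Set A}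
    (hX : X ⊆ C.F) (hz : z ∈ C.F) (hb : ∀ y ∈ X, y ⊆ z) : ⋃₀ X ∈ C.F :=
  C.unionClosed X hX fun _ hY _ => ⟨z, hz, fun y hy => hb y (hY hy)⟩

/-- A partial order with finite principal lower sets is a realisation as soon as its
principal lower sets and its whole carrier have configurations as images. -/
def Realisation.ofPrincipal (carrier : Type u) (le : carrier → carrier → Prop)
    (le_refl : ∀ a, le a a) (le_trans : ∀ a b c, le a b → le b c → le a c)
    (le_antisymm : ∀ a b, le a b → le b a → a = b)
    (finPast : ∀ e, {e' | le e' e}.Finite) (ρ : carrier → A)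
    (principal : ∀ a, ρ '' {b | le b a} ∈ C.F) (whole : Set.range ρ ∈ C.F) :
    Realisation C where
  carrier := carrier
  le := le
  le_refl := le_refl
  le_trans := le_trans
  le_antisymm := le_antisymm
  finPast := finPast
  ρ := ρ
  real x hx := by
    have h : ρ '' x = ⋃₀ {y | ∃ a ∈ x, y = ρ '' {b | le b a}} := by
      ext c
      constructor
      · rintro ⟨a, ha, rfl⟩
        exact ⟨_, ⟨a, ha, rfl⟩, a, le_refl a, rfl⟩
      · rintro ⟨_, ⟨a, ha, rfl⟩, b, hb, rfl⟩
        exact ⟨b, hx a ha b hb, rfl⟩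
    rw [h]
    refine C.sUnion_mem_of_bounded ?_ whole ?_
    · rintro _ ⟨a, _, rfl⟩
      exact principal a
    · rintro _ ⟨a, _, rfl⟩
      exact Set.image_subset_range _ _

theorem Realisation.principal_mem (r : Realisation C) (a : r.carrier) :
    r.ρ '' {b | r.le b a} ∈ C.F :=
  r.real _ fun b hb c hc => r.le_trans c b a hc hb

theorem Realisation.range_mem (r : Realisation C) : Set.range r.ρ ∈ C.F := by
  rw [← Set.image_univ]
  exact r.real _ fun _ _ _ _ => trivial

theorem Realisation.HasTop.finite {r : Realisation C} (h : r.HasTop) : Finite r.carrier := by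
  obtain ⟨t, ht⟩ := h
  exact Set.finite_univ_iff.1 ((r.finPast t).subset fun a _ => ht a)

namespace RealMap

variable {r r' r'' : Realisation C}

/-- Predecessors of a result lift to predecessors of the argument. -/
theorem exists_le_of_le (m : RealMap r r') {a : r.carrier} {b b' : r'.carrier}
    (h : m.f a = some b) (hb : r'.le b' b) : ∃ a', r.le a' a ∧ m.f a' = some b' :=
  m.presDown {a' | r.le a' a} (fun c hc d hd => r.le_trans d c a hd hc) b
    ⟨a, r.le_refl a, h⟩ _ hb

/-- A map of realisations from a partial function which lifts predecessors. -/
def ofLift (f : r.carrier → Option r'.carrier) (surj : ∀ b, ∃ a, f a = some b)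
    (lift : ∀ a b b', f a = some b → r'.le b' b → ∃ a', r.le a' a ∧ f a' = some b')
    (commutes : ∀ a b, f a = some b → r.ρ a = r'.ρ b) : RealMap r r' where
  f := f
  surj := surj
  presDown x hx := by
    rintro b ⟨a, ha, hab⟩ b' hb
    obtain ⟨a', ha', h⟩ := lift a b b' hab hb
    exact ⟨a', hx a ha a' ha', h⟩
  commutes := commutes

/-- The identity map. -/
def id (r : Realisation C) : RealMap r r :=
  ofLift some (fun b => ⟨b, rfl⟩)
    (fun _ _ b' h hb => ⟨b', by cases h; exact hb, rfl⟩) (fun _ _ h => by cases h; rfl)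

/-- Composition of maps of realisations, as partial functions. -/
def comp (m : RealMap r r') (m' : RealMap r' r'') : RealMap r r'' :=
  ofLift (fun a => (m.f a).bind m'.f)
    (fun c => by
      obtain ⟨b, hb⟩ := m'.surj c
      obtain ⟨a, ha⟩ := m.surj b
      exact ⟨a, by simp [ha, hb]⟩)
    (fun a c c' h hc => by
      obtain ⟨b, hb, hbc⟩ := Option.bind_eq_some_iff.1 h
      obtain ⟨b', hb', h'⟩ := m'.exists_le_of_le hbc hc
      obtain ⟨a', ha', h''⟩ := m.exists_le_of_le hb hb'
      exact ⟨a', ha', by simp [h'', h']⟩)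
    (fun a c h => by
      obtain ⟨b, hb, hbc⟩ := Option.bind_eq_some_iff.1 h
      rw [m.commutes a b hb, m'.commutes b c hbc])

theorem comp_eq_some_iff (m : RealMap r r') (m' : RealMap r' r'') {a : r.carrier}
    {c : r''.carrier} :
    (m.comp m').f a = some c ↔ ∃ b, m.f a = some b ∧ m'.f b = some c :=
  Option.bind_eq_some_iff

/-- An isomorphism is monotone. -/
theorem IsIso.le {m : RealMap r r'} (hm : m.IsIso) {a a' : r.carrier} {b b' : r'.carrier}
    (h : m.f a = some b) (h' : m.f a' = some b') (ha : r.le a' a) : r'.le b' b := by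
  obtain ⟨k, hk⟩ := hm
  obtain ⟨c, hc, hca⟩ := k.exists_le_of_le ((hk a b).1 h) ha
  rw [← hk, h'] at hca
  cases hca
  exact hc

/-- A total injective monotone map is an isomorphism. -/
theorem isIso_of_injective_of_monotone (m : RealMap r r') (ht : m.IsTotal)
    (hi : ∀ a a' b, m.f a = some b → m.f a' = some b → a = a')
    (hm : ∀ a a' b b', m.f a = some b → m.f a' = some b' → r.le a' a → r'.le b' b) :
    m.IsIso := by
  choose s hs using m.surj
  refine ⟨ofLift (fun b => some (s b)) ?_ ?_ ?_, ?_⟩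
  · intro a
    obtain ⟨b, hb⟩ := ht a
    exact ⟨b, congrArg some (hi _ _ _ (hs b) hb)⟩
  · rintro b _ a' ⟨⟩ ha
    obtain ⟨b', hb'⟩ := ht a'
    exact ⟨b', hm _ _ _ _ (hs b) hb' ha, congrArg some (hi _ _ _ (hs b') hb')⟩
  · rintro b _ ⟨⟩
    exact (m.commutes _ _ (hs b)).symm
  · intro a b
    constructor
    · intro h
      exact congrArg some (hi _ _ _ (hs b) h)
    · intro h
      have h : some (s b) = some a := h
      cases h
      exact hs b

/-- The order of the glueing of the codomain of a map with the elements where the map is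
undefined. -/
def glueLe (m : RealMap r r') :
    r'.carrier ⊕ {a // m.f a = none} → r'.carrier ⊕ {a // m.f a = none} → Prop
  | .inl b', .inl b => r'.le b' b
  | .inl b', .inr a => ∃ a', r.le a' a ∧ m.f a' = some b'
  | .inr _, .inl _ => False
  | .inr a, .inr b => r.le a.1 b.1

/-- The total function to the glueing. -/
noncomputable def glueFun (m : RealMap r r') (a : r.carrier) :
    r'.carrier ⊕ {a // m.f a = none} :=
  match h : m.f a with
  | some b => .inl b
  | none => .inr ⟨a, h⟩

theorem glueFun_some (m : RealMap r r') {a : r.carrier} {b : r'.carrier}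
    (h : m.f a = some b) : m.glueFun a = .inl b := by
  unfold glueFun
  split <;> simp_all

theorem glueFun_none (m : RealMap r r') {a : r.carrier} (h : m.f a = none) :
    m.glueFun a = .inr ⟨a, h⟩ := by
  unfold glueFun
  split <;> simp_all

theorem glueFun_surjective (m : RealMap r r') : Function.Surjective m.glueFun := by
  rintro (b | ⟨a, ha⟩)
  · obtain ⟨a, ha⟩ := m.surj b
    exact ⟨a, m.glueFun_some ha⟩
  · exact ⟨a, m.glueFun_none ha⟩

theorem glueFun_lift (m : RealMap r r') {a : r.carrier} {y : r'.carrier ⊕ {a // m.f a = none}}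
    (h : m.glueLe y (m.glueFun a)) : ∃ a', r.le a' a ∧ m.glueFun a' = y := by
  cases ha : m.f a with
  | some b =>
    rw [m.glueFun_some ha] at h
    rcases y with b' | y
    · obtain ⟨a', ha', h'⟩ := m.exists_le_of_le ha h
      exact ⟨a', ha', m.glueFun_some h'⟩
    · exact h.elim
  | none =>
    rw [m.glueFun_none ha] at h
    rcases y with b' | y
    · obtain ⟨a', ha', h'⟩ := h
      exact ⟨a', ha', m.glueFun_some h'⟩
    · exact ⟨y.1, h, m.glueFun_none y.2⟩

theorem glue_ρ (m : RealMap r r') (a : r.carrier) :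
    Sum.elim r'.ρ (fun a => r.ρ a.1) (m.glueFun a) = r.ρ a := by
  cases ha : m.f a with
  | some b => simp [m.glueFun_some ha, m.commutes a b ha]
  | none => simp [m.glueFun_none ha]

/-- The codomain of a map glued with the elements where the map is undefined. -/
noncomputable def glue (m : RealMap r r') : Realisation C :=
  Realisation.ofPrincipal (r'.carrier ⊕ {a // m.f a = none}) m.glueLe
    (by
      rintro (b | a)
      · exact r'.le_refl b
      · exact r.le_refl a.1)
    (by
      rintro (a | a) (b | b) (c | c) hab hbc
      · exact r'.le_trans _ _ _ hab hbc
      · obtain ⟨b', hb', h⟩ := hbc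
        obtain ⟨a', ha', h'⟩ := m.exists_le_of_le h hab
        exact ⟨a', r.le_trans _ _ _ ha' hb', h'⟩
      · exact hbc.elim
      · obtain ⟨a', ha', h⟩ := hab
        exact ⟨a', r.le_trans _ _ _ ha' hbc, h⟩
      · exact hab.elim
      · exact hab.elim
      · exact hbc.elim
      · exact r.le_trans _ _ _ hab hbc)
    (by
      rintro (a | a) (b | b) hab hba
      · exact congrArg _ (r'.le_antisymm _ _ hab hba)
      · exact hba.elim
      · exact hab.elim
      · exact congrArg _ (Subtype.ext (r.le_antisymm _ _ hab hba)))
    (by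
      intro e
      obtain ⟨a, rfl⟩ := m.glueFun_surjective e
      refine ((r.finPast a).image m.glueFun).subset ?_
      intro y hy
      obtain ⟨a', ha', h⟩ := m.glueFun_lift hy
      exact ⟨a', ha', h⟩)
    (Sum.elim r'.ρ fun a => r.ρ a.1)
    (by
      rintro (b | a)
      · convert r'.principal_mem b using 1
        ext c
        constructor
        · rintro ⟨b' | a', h, rfl⟩
          · exact ⟨b', h, rfl⟩
          · exact h.elim
        · rintro ⟨b', h, rfl⟩
          exact ⟨.inl b', h, rfl⟩
      · convert r.principal_mem a.1 using 1
        ext c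
        constructor
        · rintro ⟨y, h, rfl⟩
          rw [← m.glueFun_none a.2] at h
          obtain ⟨a', ha', rfl⟩ := m.glueFun_lift h
          exact ⟨a', ha', (m.glue_ρ a').symm⟩
        · rintro ⟨a', ha', rfl⟩
          refine ⟨m.glueFun a', ?_, m.glue_ρ a'⟩
          cases h : m.f a' with
          | some b => rw [m.glueFun_some h]; exact ⟨a', ha', h⟩
          | none => rw [m.glueFun_none h]; exact ha')
    (by
      convert r.range_mem using 1
      ext c
      constructor
      · rintro ⟨y, rfl⟩
        obtain ⟨a, rfl⟩ := m.glueFun_surjective y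
        exact ⟨a, (m.glue_ρ a).symm⟩
      · rintro ⟨a, rfl⟩
        exact ⟨m.glueFun a, m.glue_ρ a⟩)

/-- The total map to the glueing. -/
noncomputable def toGlue (m : RealMap r r') : RealMap r m.glue :=
  ofLift (fun a => some (m.glueFun a))
    (fun y => (m.glueFun_surjective y).imp fun _ h => congrArg some h)
    (by
      rintro a _ y ⟨⟩ h
      obtain ⟨a', ha', rfl⟩ := m.glueFun_lift h
      exact ⟨a', ha', rfl⟩)
    (by
      rintro a _ ⟨⟩
      exact (m.glue_ρ a).symm)

end RealMap

namespace Realisation.Extremal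

variable {r r' : Realisation C}

theorem glueLe_of_le (hr : r.Extremal) (m : RealMap r r') {a a' : r.carrier}
    (h : r.le a' a) : m.glueLe (m.glueFun a') (m.glueFun a) :=
  (hr m.glue m.toGlue fun _ => ⟨_, rfl⟩).le (m := m.toGlue) rfl rfl h

/-- The domain of definition of a map from an extremal realisation is down-closed. -/
theorem exists_eq_some_of_le (hr : r.Extremal) (m : RealMap r r') {a a' : r.carrier}
    {b : r'.carrier} (h : m.f a = some b) (ha : r.le a' a) : ∃ b', m.f a' = some b' := by
  have hg := hr.glueLe_of_le m ha
  cases h' : m.f a' with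
  | some b' => exact ⟨b', rfl⟩
  | none =>
    rw [m.glueFun_some h, m.glueFun_none h'] at hg
    exact hg.elim

/-- A map from an extremal realisation is monotone on its domain of definition. -/
theorem map_le (hr : r.Extremal) (m : RealMap r r') {a a' : r.carrier}
    {b b' : r'.carrier} (h : m.f a = some b) (h' : m.f a' = some b') (ha : r.le a' a) :
    r'.le b' b := by
  have hg := hr.glueLe_of_le m ha
  rw [m.glueFun_some h, m.glueFun_some h'] at hg
  exact hg

/-- A map from an extremal realisation is injective on its domain of definition. -/
theorem map_injective (hr : r.Extremal) (m : RealMap r r') {a a' : r.carrier}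
    {b : r'.carrier} (h : m.f a = some b) (h' : m.f a' = some b) : a = a' := by
  obtain ⟨k, hk⟩ := hr m.glue m.toGlue fun _ => ⟨_, rfl⟩
  have e : m.toGlue.f a = some (.inl b) := congrArg some (m.glueFun_some h)
  have e₂ : m.toGlue.f a' = some (.inl b) := congrArg some (m.glueFun_some h')
  exact Option.some.inj (((hk _ _).1 e).symm.trans ((hk _ _).1 e₂))

/-- A map from an extremal realisation reflects the order. -/
theorem le_of_map_le (hr : r.Extremal) (m : RealMap r r') {a a' : r.carrier}
    {b b' : r'.carrier} (h : m.f a = some b) (h' : m.f a' = some b') (hb : r'.le b' b) :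
    r.le a' a := by
  obtain ⟨c, hc, hcb⟩ := m.exists_le_of_le h hb
  rwa [hr.map_injective m h' hcb]

end Realisation.Extremal

namespace Realisation

/-- The number of pairs in the order of a realisation. -/
noncomputable def orderCard (r : Realisation C) : ℕ :=
  Nat.card {x : r.carrier × r.carrier // r.le x.1 x.2}

theorem exists_orderPair_injection {r r' : Realisation C} (m : RealMap r r') :
    ∃ j : {x : r'.carrier × r'.carrier // r'.le x.1 x.2} →
        {x : r.carrier × r.carrier // r.le x.1 x.2},
      Function.Injective j ∧
        ∀ x, m.f (j x).1.1 = some x.1.1 ∧ m.f (j x).1.2 = some x.1.2 := by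
  have h : ∀ x : {x : r'.carrier × r'.carrier // r'.le x.1 x.2},
      ∃ y : {x : r.carrier × r.carrier // r.le x.1 x.2},
        m.f y.1.1 = some x.1.1 ∧ m.f y.1.2 = some x.1.2 := by
    rintro ⟨⟨b', b⟩, hb⟩
    obtain ⟨a, ha⟩ := m.surj b
    obtain ⟨a', ha', h⟩ := m.exists_le_of_le ha hb
    exact ⟨⟨(a', a), ha'⟩, h, ha⟩
  choose j hj using h
  refine ⟨j, fun x y hxy => ?_, hj⟩
  have h₁ := hj x
  rw [hxy] at h₁
  exact Subtype.ext (Prod.ext (Option.some.inj (h₁.1.symm.trans (hj y).1))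
    (Option.some.inj (h₁.2.symm.trans (hj y).2)))

/-- A total map between finite realisations which does not decrease the number of pairs in
the order is an isomorphism. -/
theorem isIso_of_orderCard_le {r r' : Realisation C} [Finite r.carrier] (m : RealMap r r')
    (ht : m.IsTotal) (hc : r.orderCard ≤ r'.orderCard) : m.IsIso := by
  obtain ⟨j, hj, h⟩ := exists_orderPair_injection m
  have hs := (hj.bijective_of_nat_card_le hc).2
  refine m.isIso_of_injective_of_monotone ht ?_ ?_
  · intro a a' b ha ha'
    obtain ⟨⟨⟨x₁, x₂⟩, hx⟩, hxa⟩ := hs ⟨(a, a), r.le_refl a⟩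
    obtain ⟨⟨⟨y₁, y₂⟩, hy⟩, hya⟩ := hs ⟨(a', a'), r.le_refl a'⟩
    have e₁ := h ⟨⟨x₁, x₂⟩, hx⟩
    have e₂ := h ⟨⟨y₁, y₂⟩, hy⟩
    rw [hxa] at e₁
    rw [hya] at e₂
    simp only [ha, ha', Option.some.injEq] at e₁ e₂
    obtain ⟨rfl, rfl⟩ := e₁
    obtain ⟨rfl, rfl⟩ := e₂
    have := congrArg (fun z => z.1.1) (hxa.symm.trans hya)
    exact this
  · intro a a' b b' ha ha' hle
    obtain ⟨⟨⟨x₁, x₂⟩, hx⟩, hxa⟩ := hs ⟨(a', a), hle⟩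
    have e₁ := h ⟨⟨x₁, x₂⟩, hx⟩
    rw [hxa] at e₁
    simp only [ha, ha', Option.some.injEq] at e₁
    obtain ⟨rfl, rfl⟩ := e₁
    exact hx

/-- Every finite realisation has a total map to an extremal realisation. -/
theorem exists_total_extremal (r : Realisation C) [Finite r.carrier] :
    ∃ (e : Realisation C) (m : RealMap r e), e.Extremal ∧ m.IsTotal := by
  classical
  have hex : ∃ (n : ℕ) (e : Realisation C) (m : RealMap r e), m.IsTotal ∧ e.orderCard = n :=
    ⟨_, r, RealMap.id r, fun a => ⟨a, rfl⟩, rfl⟩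
  obtain ⟨e, m, hm, hn⟩ := Nat.find_spec hex
  refine ⟨e, m, fun r' k hk => ?_, hm⟩
  have : Finite e.carrier := by
    choose s hs using m.surj
    exact Finite.of_injective s fun x y hxy =>
      Option.some.inj ((hs x).symm.trans (hxy ▸ hs y))
  refine isIso_of_orderCard_le k hk ?_
  rw [hn]
  refine Nat.find_min' hex ⟨r', m.comp k, fun a => ?_, rfl⟩
  obtain ⟨b, hb⟩ := hm a
  obtain ⟨c, hc⟩ := hk b
  exact ⟨c, (m.comp_eq_some_iff k).2 ⟨b, hb, hc⟩⟩

/-- A finite partial order, in any universe, whose principal lower sets and whole carrier have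
configurations as images, maps onto an extremal realisation. -/
theorem exists_extremal_of_finite {α : Type w} [Finite α] (le : α → α → Prop)
    (le_refl : ∀ a, le a a) (le_trans : ∀ a b c, le a b → le b c → le a c)
    (le_antisymm : ∀ a b, le a b → le b a → a = b) (ρ : α → A)
    (principal : ∀ a, ρ '' {b | le b a} ∈ C.F) (whole : Set.range ρ ∈ C.F) :
    ∃ (e : Realisation C) (g : α → e.carrier), e.Extremal ∧
      (∀ a b, e.le b (g a) → ∃ a', le a' a ∧ g a' = b) ∧ ∀ a, e.ρ (g a) = ρ a := by
  let s := equivShrink.{u} α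
  have : Finite (Shrink.{u} α) := Finite.of_equiv α s
  let r : Realisation C := ofPrincipal (Shrink.{u} α) (fun x y => le (s.symm x) (s.symm y))
    (fun _ => le_refl _) (fun _ _ _ => le_trans _ _ _)
    (fun _ _ h h' => s.symm.injective (le_antisymm _ _ h h')) (fun _ => Set.toFinite _)
    (fun x => ρ (s.symm x))
    (by
      intro x
      convert principal (s.symm x) using 1
      ext c
      constructor
      · rintro ⟨y, hy, rfl⟩
        exact ⟨_, hy, rfl⟩
      · rintro ⟨y, hy, rfl⟩
        exact ⟨s y, by simpa using hy, by simp⟩)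
    (by
      convert whole using 1
      exact s.symm.surjective.range_comp ρ)
  have : Finite r.carrier := ‹Finite (Shrink.{u} α)›
  obtain ⟨e, m, he, hm⟩ := r.exists_total_extremal
  choose g hg using hm
  refine ⟨e, fun a => g (s a), he, fun a b hb => ?_, fun a => ?_⟩
  · obtain ⟨x, hx, hxb⟩ := m.exists_le_of_le (hg (s a)) hb
    refine ⟨s.symm x, ?_, ?_⟩
    · have hx : le (s.symm x) (s.symm (s a)) := hx
      simpa using hx
    · exact (congrArg g (s.apply_symm_apply x)).trans (Option.some.inj ((hg x).symm.trans hxb))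
  · rw [← m.commutes _ _ (hg (s a))]
    exact congrArg ρ (s.symm_apply_apply a)

/-- The restriction of a realisation to the elements below a given one. -/
def below (r : Realisation C) (e : r.carrier) : Realisation C where
  carrier := {a // r.le a e}
  le a b := r.le a.1 b.1
  le_refl a := r.le_refl a.1
  le_trans a b c := r.le_trans a.1 b.1 c.1
  le_antisymm a b h h' := Subtype.ext (r.le_antisymm _ _ h h')
  finPast a := (r.finPast a.1).preimage Subtype.val_injective.injOn
  ρ a := r.ρ a.1
  real x hx := by
    have h := r.real (Subtype.val '' x) (by
      rintro _ ⟨a, ha, rfl⟩ b hb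
      exact ⟨⟨b, r.le_trans _ _ _ hb a.2⟩, hx a ha _ hb, rfl⟩)
    rwa [Set.image_image] at h

open Classical in
/-- The projection to the elements below a given one. -/
noncomputable def toBelow (r : Realisation C) (e : r.carrier) : RealMap r (r.below e) :=
  RealMap.ofLift (fun a => if h : r.le a e then some ⟨a, h⟩ else none)
    (fun b => ⟨b.1, dif_pos b.2⟩)
    (by
      intro a b b' h hb
      split at h
      · cases h
        exact ⟨b'.1, hb, dif_pos b'.2⟩
      · cases h)
    (by
      intro a b h
      split at h
      · cases h
        rfl
      · cases h)

theorem toBelow_eq_some (r : Realisation C) {e a : r.carrier} (h : r.le a e) :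
    (r.toBelow e).f a = some ⟨a, h⟩ :=
  dif_pos h

theorem Extremal.below {r : Realisation C} (hr : r.Extremal) (e : r.carrier) :
    (r.below e).PrimeExtremal := by
  refine ⟨fun r' m hm => ?_, ⟨e, r.le_refl e⟩, fun a => a.2⟩
  have hc : ∀ (a : (r.below e).carrier) (b : r'.carrier), m.f a = some b →
      ((r.toBelow e).comp m).f a.1 = some b := fun a b h =>
    ((r.toBelow e).comp_eq_some_iff m).2 ⟨a, r.toBelow_eq_some a.2, h⟩
  refine m.isIso_of_injective_of_monotone hm ?_ ?_
  · intro a a' b h h'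
    exact Subtype.ext (hr.map_injective _ (hc a b h) (hc a' b h'))
  · intro a₁ a₂ b₁ b₂ h₁ h₂ hle
    exact hr.map_le _ (hc a₁ b₁ h₁) (hc a₂ b₂ h₂) hle

/-- The realisation `p` is represented by the element `e` of `r`: some map from `r` to `p`
sends `e` to a top element. -/
def Represents (r : Realisation C) (e : r.carrier) (p : Realisation C) : Prop :=
  ∃ (m : RealMap r p) (t : p.carrier), (∀ a, p.le a t) ∧ m.f e = some t

end Realisation

variable {P : Set (Realisation C)}

theorem erLe_refl (p : ↥P) : erLe P p p := ⟨RealMap.id p.1⟩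

theorem erLe_trans {p q s : ↥P} : erLe P p q → erLe P q s → erLe P p s :=
  fun ⟨m⟩ ⟨m'⟩ => ⟨m'.comp m⟩

theorem erLe_antisymm (hP : erChoice P) {p q : ↥P} (h : erLe P p q) (h' : erLe P q p) :
    p = q := by
  obtain ⟨m⟩ := h'
  obtain ⟨m'⟩ := h
  have : Finite p.1.carrier := (hP.1 p.1 p.2).2.finite
  choose s hs using m.surj
  choose s' hs' using m'.surj
  have hsi : Function.Injective s := fun x y hxy =>
    Option.some.inj ((hs x).symm.trans (hxy ▸ hs y))
  have hsi' : Function.Injective s' := fun x y hxy =>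
    Option.some.inj ((hs' x).symm.trans (hxy ▸ hs' y))
  have hsurj : Function.Surjective s :=
    (Finite.surjective_of_injective (hsi.comp hsi')).of_comp
  have hiso : m.IsIso := (hP.1 p.1 p.2).1 _ m fun a => by
    obtain ⟨b, rfl⟩ := hsurj a
    exact ⟨b, hs b⟩
  obtain ⟨x, -, hx⟩ := hP.2 q.1 (hP.1 q.1 q.2)
  refine Subtype.ext ((hx p.1 ⟨p.2, m, hiso⟩).trans (hx q.1 ⟨q.2, RealMap.id q.1, ?_⟩).symm)
  exact ⟨RealMap.id q.1, fun a b => by simp [RealMap.id, RealMap.ofLift, eq_comm]⟩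

namespace Realisation.Represents

variable {r : Realisation C}

theorem exists_erChoice (hP : erChoice P) (hr : r.Extremal) (e : r.carrier) :
    ∃ p : ↥P, r.Represents e p.1 := by
  obtain ⟨p, ⟨hp, k, k', hk⟩, -⟩ := hP.2 _ (hr.below e)
  have he : r.le e e := r.le_refl e
  obtain ⟨t, ht⟩ := k.surj ⟨e, he⟩
  have hc : ((r.toBelow e).comp k').f e = some t :=
    ((r.toBelow e).comp_eq_some_iff k').2 ⟨_, r.toBelow_eq_some he, (hk _ _).1 ht⟩
  refine ⟨⟨p, hp⟩, (r.toBelow e).comp k', t, fun a => ?_, hc⟩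
  obtain ⟨x, hx⟩ := k'.surj a
  exact hr.map_le _ hc (((r.toBelow e).comp_eq_some_iff k').2
    ⟨x, r.toBelow_eq_some x.2, hx⟩) x.2

theorem nonempty_realMap {e : r.carrier} {p q : Realisation C} (hr : r.Extremal)
    (hp : r.Represents e p) (hq : r.Represents e q) : Nonempty (RealMap p q) := by
  obtain ⟨m, t, ht, hm⟩ := hp
  obtain ⟨k, u, hu, hk⟩ := hq
  choose s hs using m.surj
  refine ⟨RealMap.ofLift (fun b => k.f (s b)) ?_ ?_ ?_⟩
  · intro c
    obtain ⟨a, ha⟩ := k.surj c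
    obtain ⟨b, hb⟩ := hr.exists_eq_some_of_le m hm (hr.le_of_map_le k hk ha (hu c))
    exact ⟨b, by rwa [hr.map_injective m (hs b) hb]⟩
  · intro b c c' hc hle
    obtain ⟨a', ha', hac⟩ := k.exists_le_of_le hc hle
    obtain ⟨b', hb'⟩ := hr.exists_eq_some_of_le m (hs b) ha'
    exact ⟨b', hr.map_le m (hs b) hb' ha', by rwa [hr.map_injective m (hs b') hb']⟩
  · intro b c hc
    rw [← m.commutes _ _ (hs b), k.commutes _ _ hc]

theorem eq {e : r.carrier} {p q : ↥P} (hP : erChoice P) (hr : r.Extremal)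
    (hp : r.Represents e p.1) (hq : r.Represents e q.1) : p = q :=
  erLe_antisymm hP (hq.nonempty_realMap hr hp) (hp.nonempty_realMap hr hq)

theorem exists_of_erLe {e : r.carrier} {p q : ↥P} (hP : erChoice P) (hr : r.Extremal)
    (hp : r.Represents e p.1) (hq : erLe P q p) : ∃ e', r.le e' e ∧ r.Represents e' q.1 := by
  obtain ⟨m, t, ht, hm⟩ := hp
  obtain ⟨k⟩ := hq
  obtain ⟨u, hu⟩ := (hP.1 q.1 q.2).2
  obtain ⟨e', he'⟩ := (m.comp k).surj u
  obtain ⟨b, hb, -⟩ := (m.comp_eq_some_iff k).1 he'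
  exact ⟨e', hr.le_of_map_le m hm hb (ht b), m.comp k, u, hu, he'⟩

theorem ρ_eq {mx : ↥P → A} (hmx : erMax mx) {e : r.carrier} {p : ↥P}
    (hp : r.Represents e p.1) : mx p = r.ρ e := by
  obtain ⟨m, t, ht, hm⟩ := hp
  obtain ⟨u, hu, h⟩ := hmx p
  rw [h, m.commutes e t hm, p.1.le_antisymm u t (ht u) (hu t)]

/-- A chosen prime is represented by its own top. -/
theorem exists_self (hP : erChoice P) (p : ↥P) :
    ∃ t, (∀ a, p.1.le a t) ∧ p.1.Represents t p.1 := by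
  obtain ⟨t, ht⟩ := (hP.1 p.1 p.2).2
  exact ⟨t, ht, RealMap.id p.1, t, ht, rfl⟩

end Realisation.Represents

/-- The principal configurations of the causal unfolding have configurations as images. -/
theorem image_erLe_mem (hP : erChoice P) {mx : ↥P → A} (hmx : erMax mx) (p : ↥P) :
    mx '' {q | erLe P q p} ∈ C.F := by
  convert p.1.range_mem using 1
  ext c
  constructor
  · rintro ⟨q, hq, rfl⟩
    obtain ⟨t, -, ht⟩ := Realisation.Represents.exists_self hP p
    obtain ⟨e, -, he⟩ := ht.exists_of_erLe hP (hP.1 p.1 p.2).1 hq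
    exact ⟨e, (he.ρ_eq hmx).symm⟩
  · rintro ⟨e, rfl⟩
    obtain ⟨q, hq⟩ := Realisation.Represents.exists_erChoice hP (hP.1 p.1 p.2).1 e
    exact ⟨q, ⟨hq.choose⟩, hq.ρ_eq hmx⟩

theorem image_mem_of_subset (hP : erChoice P) {mx : ↥P → A} (hmx : erMax mx) {X : Set ↥P}
    {z : Set A} (hz : z ∈ C.F) (hX : mx '' {p | ∃ q ∈ X, erLe P p q} ⊆ z) :
    mx '' {p | ∃ q ∈ X, erLe P p q} ∈ C.F := by
  have h : mx '' {p | ∃ q ∈ X, erLe P p q} =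
      ⋃₀ {y | ∃ q ∈ X, y = mx '' {p | erLe P p q}} := by
    ext c
    constructor
    · rintro ⟨p, ⟨q, hq, hpq⟩, rfl⟩
      exact ⟨_, ⟨q, hq, rfl⟩, p, hpq, rfl⟩
    · rintro ⟨_, ⟨q, hq, rfl⟩, p, hpq, rfl⟩
      exact ⟨p, ⟨q, hq, hpq⟩, rfl⟩
  rw [h] at hX ⊢
  refine C.sUnion_mem_of_bounded ?_ hz fun y hy => (Set.subset_sUnion_of_mem hy).trans hX
  rintro _ ⟨q, _, rfl⟩
  exact image_erLe_mem hP hmx q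

/-- The counit is a map of equivalence families. -/
theorem isEFMap_counit {eqA : A → A → Prop} {mx : ↥P → A} :
    IsEFMap (Cfgs (erData P eqA mx)) (erData P eqA mx).eqv C.F eqA (fun p => some (mx p)) := by
  refine ⟨fun p q h => .inr ⟨_, _, rfl, rfl, h⟩, fun x hx => ⟨?_, ?_⟩⟩
  · have h : pimage (fun p => some (mx p)) x =
        ⋃₀ {y | ∃ q ∈ x, y = mx '' {p | erLe P p q}} := by
      ext c
      constructor
      · rintro ⟨p, hp, ⟨⟩⟩
        exact ⟨_, ⟨p, hp, rfl⟩, p, erLe_refl p, rfl⟩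
      · rintro ⟨_, ⟨q, hq, rfl⟩, p, hp, rfl⟩
        exact ⟨p, hx.1 q hq p hp, rfl⟩
    rw [h]
    refine C.unionClosed _ ?_ fun Y hY hYf => ?_
    · rintro _ ⟨q, hq, rfl⟩
      simpa using (hx.2 {q} (by simpa using hq) (Set.finite_singleton q)).2
    · have hY' : ∀ y : ↥Y, ∃ q ∈ x, y.1 = mx '' {p | erLe P p q} := fun y => hY y.2
      choose s hs hys using hY'
      have : Finite ↥Y := hYf
      refine ⟨_, (hx.2 (Set.range s) (Set.range_subset_iff.2 hs) (Set.finite_range s)).2,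
        fun y hy => ?_⟩
      refine (hys ⟨y, hy⟩).subset.trans ?_
      exact Set.image_mono fun p hp => ⟨_, ⟨⟨y, hy⟩, rfl⟩, hp⟩
  · rintro p _ q _ _ _ ⟨⟩ ⟨⟩ h
    exact h

/-- A finite down-closed set `H` of the causal unfolding, extended by an event `a` to a
configuration, determines a prime with image `a` whose strict predecessors lie in `H`. -/
theorem exists_prime_extension (hP : erChoice P) {mx : ↥P → A} (hmx : erMax mx)
    {H : Set ↥P} (hf : H.Finite) (hd : DnClosed (erLe P) H) {a : A}
    (ha : insert a (mx '' H) ∈ C.F) :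
    ∃ p₀ : ↥P, mx p₀ = a ∧ ∀ p, erLe P p p₀ → p = p₀ ∨ p ∈ H := by
  have : Finite ↥H := hf
  let le : Option ↥H → Option ↥H → Prop := fun x y =>
    ∀ q, y = some q → ∃ p, x = some p ∧ erLe P p.1 q.1
  let ρ : Option ↥H → A := fun x => x.elim a fun p => mx p.1
  have hrange : Set.range ρ = insert a (mx '' H) := by
    ext c
    constructor
    · rintro ⟨_ | p, rfl⟩
      · exact .inl rfl
      · exact .inr ⟨p.1, p.2, rfl⟩
    · rintro (rfl | ⟨p, hp, rfl⟩)
      · exact ⟨none, rfl⟩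
      · exact ⟨some ⟨p, hp⟩, rfl⟩
  obtain ⟨E, g, hE, hlift, hρ⟩ := Realisation.exists_extremal_of_finite (C := C) le
    (fun x q h => ⟨q, h, erLe_refl _⟩)
    (fun x y z hxy hyz q hq => by
      obtain ⟨p, hp, hpq⟩ := hyz q hq
      obtain ⟨s, hs, hsp⟩ := hxy p hp
      exact ⟨s, hs, erLe_trans hsp hpq⟩)
    (fun x y hxy hyx => by
      rcases y with _ | q
      · rcases x with _ | p
        · rfl
        · obtain ⟨_, ⟨⟩, _⟩ := hyx p rfl
      · obtain ⟨p, rfl, hpq⟩ := hxy q rfl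
        obtain ⟨_, ⟨⟩, hqp⟩ := hyx p rfl
        exact congrArg some (Subtype.ext (erLe_antisymm hP hpq hqp)))
    ρ
    (by
      rintro (_ | q)
      · have : {b | le b none} = Set.univ := Set.eq_univ_of_forall fun _ _ h => by cases h
        rwa [this, Set.image_univ, hrange]
      · convert image_erLe_mem hP hmx q.1 using 1
        ext c
        constructor
        · rintro ⟨x, hx, rfl⟩
          obtain ⟨p, rfl, hp⟩ := hx q rfl
          exact ⟨p.1, hp, rfl⟩
        · rintro ⟨p, hp, rfl⟩
          refine ⟨some ⟨p, hd q.1 q.2 p hp⟩, ?_, rfl⟩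
          rintro _ ⟨⟩
          exact ⟨_, rfl, hp⟩)
    (hrange ▸ ha)
  obtain ⟨p₀, hp₀⟩ := Realisation.Represents.exists_erChoice hP hE (g none)
  refine ⟨p₀, (hp₀.ρ_eq hmx).trans (hρ none), fun p hp => ?_⟩
  obtain ⟨e, he, hep⟩ := hp₀.exists_of_erLe hP hE hp
  obtain ⟨y, -, rfl⟩ := hlift none e he
  rcases y with _ | p₁
  · exact .inl (hep.eq hP hE hp₀)
  refine .inr ?_
  have h₁ := (hP.1 p₁.1.1 p₁.1.2).1
  choose φ hφ using fun b => Realisation.Represents.exists_erChoice hP h₁ b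
  have hφH : ∀ b, φ b ∈ H := fun b => hd p₁.1 p₁.2 _ ⟨(hφ b).choose⟩
  obtain ⟨t, ht, htr⟩ := Realisation.Represents.exists_self hP p₁.1
  have hφt : φ t = p₁.1 := (hφ t).eq hP h₁ htr
  have hlow : ∀ b e', E.le e' (g (some ⟨φ b, hφH b⟩)) →
      ∃ b', p₁.1.1.le b' b ∧ g (some ⟨φ b', hφH b'⟩) = e' := by
    intro b e' he'
    obtain ⟨y, hy, rfl⟩ := hlift _ _ he'
    obtain ⟨q, rfl, hq⟩ := hy _ rfl
    obtain ⟨b', hb', hr⟩ := (hφ b).exists_of_erLe hP h₁ hq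
    refine ⟨b', hb', ?_⟩
    have hq' : (⟨φ b', hφH b'⟩ : ↥H) = q := Subtype.ext ((hφ b').eq hP h₁ hr)
    rw [hq']
  have hgt : g (some ⟨φ t, hφH t⟩) = g (some p₁) := by
    congr 2
    exact Subtype.ext hφt
  obtain ⟨μ, u, hu, hμ⟩ := hep
  have hrep : p₁.1.1.Represents t p.1 := by
    refine ⟨RealMap.ofLift (fun b => μ.f (g (some ⟨φ b, hφH b⟩))) ?_ ?_ ?_, u, hu,
      (congrArg μ.f hgt).trans hμ⟩
    · intro c
      obtain ⟨e', he', h⟩ := μ.exists_le_of_le hμ (hu c)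
      rw [← hgt] at he'
      obtain ⟨b', -, rfl⟩ := hlow t e' he'
      exact ⟨b', h⟩
    · intro b c c' hc hle
      obtain ⟨e', he', h⟩ := μ.exists_le_of_le hc hle
      obtain ⟨b', hb', rfl⟩ := hlow b e' he'
      exact ⟨b', hb', h⟩
    · intro b c hc
      rw [← μ.commutes _ _ hc, hρ]
      exact ((hφ b).ρ_eq hmx).symm
  have hpp : p = p₁.1 := hrep.eq hP h₁ htr
  rw [hpp]
  exact p₁.2

/-- Choice along a well-founded relation, of values constrained by the values at predecessors. -/
theorem exists_forall_of_wellFounded {α : Type v} {β : Type w} [Nonempty β]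
    {lt : α → α → Prop} (wf : WellFounded lt) (Good : α → (α → β) → β → Prop)
    (congr : ∀ a g g' b, (∀ a', lt a' a → g a' = g' a') → Good a g b → Good a g' b)
    (step : ∀ a g, (∀ a', lt a' a → Good a' g (g a')) → ∃ b, Good a g b) :
    ∃ h : α → β, ∀ a, Good a h (h a) := by
  classical
  let F : ∀ a, (∀ a', lt a' a → β) → β := fun a g =>
    Classical.epsilon (Good a fun a' =>
      if h : lt a' a then g a' h else Classical.arbitrary β)
  refine ⟨wf.fix F, fun a => ?_⟩
  induction a using wf.induction with | _ a ih
  obtain ⟨b, hb⟩ := step a (wf.fix F) ih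
  have hext : ∀ a', lt a' a → wf.fix F a' =
      if _h : lt a' a then wf.fix F a' else Classical.arbitrary β := fun a' h => by
    rw [dif_pos h]
  have hF := Classical.epsilon_spec ⟨b, congr a _ _ b hext hb⟩
  rw [wf.fix_eq]
  exact congr a _ _ _ (fun a' h => (hext a' h).symm) hF

theorem IsESE.wellFounded {Q : Type v} {D : ESEData Q} (hD : IsESE D) :
    WellFounded fun a b => D.le a b ∧ a ≠ b := by
  refine Subrelation.wf (r := InvImage (· < ·) fun e => {e' | D.le e' e}.ncard) ?_
    (InvImage.wf _ Nat.lt_wfRel.wf)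
  rintro a b ⟨hab, hne⟩
  refine Set.ncard_lt_ncard ⟨fun c hc => hD.le_trans c a b hc hab, fun h => hne ?_⟩
    (hD.finCause b)
  exact hD.le_antisymm a b hab (h (hD.le_refl b))

/-- Principal lower sets are configurations. -/
theorem IsESE.principal_mem_cfgs {Q : Type v} {D : ESEData Q} (hD : IsESE D) (q : Q) :
    {e | D.le e q} ∈ Cfgs D := by
  refine ⟨fun a ha b hb => hD.le_trans b a q hb ha, fun X hX hf => ?_⟩
  refine hD.con_mono X (insert q X) (Set.subset_insert q X) ?_
  induction X, hf using Set.Finite.induction_on with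
  | empty => simpa using hD.con_single q
  | @insert e S _ _ ih =>
    have h := hD.con_le _ (ih ((Set.subset_insert e S).trans hX)) e q
      (hX (Set.mem_insert e S)) (Set.mem_insert q S)
    rwa [Set.union_singleton, Set.insert_comm] at h

end CausalUnfolding

/-- The universal property of the causal unfolding: the counit
`ε(p) = max(p)` is a map of equivalence families from the configurations of
`er(A)` to `A`, and every map of equivalence families from the configurations
of an ese `Q` to `A` factors through it via a map of ese's `h : Q → er(A)`,
uniquely up to the equivalence on maps. -/
theorem stmt13 {A : Type u} (C : ConfigFamily A) (eqA : A → A → Prop)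
    (heq : Equivalence eqA) (P : Set (Realisation C)) (hP : erChoice P)
    (mx : ↥P → A) (hmx : erMax mx) :
    IsEFMap (Cfgs (erData P eqA mx)) (erData P eqA mx).eqv C.F eqA
      (fun p => some (mx p)) ∧
    ∀ (Qt : Type v) (DQ : ESEData Qt), IsESE DQ →
      ∀ f : Qt → Option A, IsEFMap (Cfgs DQ) DQ.eqv C.F eqA f →
        ∃ h : Qt → Option ↥P, IsESEMap DQ (erData P eqA mx) h ∧
          (∀ q, f q = (h q).map mx) ∧
          ∀ h' : Qt → Option ↥P, IsESEMap DQ (erData P eqA mx) h' →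
            MapEqv eqA f (fun q => (h' q).map mx) →
            MapEqv (erData P eqA mx).eqv h' h := by
  refine ⟨isEFMap_counit, fun Qt DQ hQ f hf => ?_⟩
  obtain ⟨h, hh⟩ := exists_forall_of_wellFounded hQ.wellFounded
    (fun q (g : Qt → Option ↥P) v => f q = v.map mx ∧ ∀ p p₀, v = some p₀ → erLe P p p₀ →
      p = p₀ ∨ ∃ q', (DQ.le q' q ∧ q' ≠ q) ∧ g q' = some p)
    (fun q g g' v hg hv => ⟨hv.1, fun p p₀ hp₀ hp => (hv.2 p p₀ hp₀ hp).imp_right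
      fun ⟨q', hq', h⟩ => ⟨q', hq', hg q' hq' ▸ h⟩⟩)
    (by
      intro q g hg
      cases hq : f q with
      | none => exact ⟨none, rfl, fun _ _ h => by cases h⟩
      | some a =>
        have hfin : {p | ∃ q', (DQ.le q' q ∧ q' ≠ q) ∧ g q' = some p}.Finite := by
          refine Set.Finite.of_finite_image (f := some)
            (((hQ.finCause q).image g).subset ?_) (Option.some_injective _).injOn
          rintro _ ⟨p, ⟨q', hq', h⟩, rfl⟩
          exact ⟨q', hq'.1, h⟩
        have hlt : ∀ q₁ q₂, DQ.le q₁ q₂ → DQ.le q₂ q ∧ q₂ ≠ q → DQ.le q₁ q ∧ q₁ ≠ q := by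
          rintro q₁ q₂ h₁ ⟨h₂, hne⟩
          refine ⟨hQ.le_trans _ _ _ h₁ h₂, ?_⟩
          rintro rfl
          exact hne (hQ.le_antisymm _ _ h₂ h₁)
        obtain ⟨p₀, hp₀, h⟩ := exists_prime_extension hP hmx hfin
          (by
            rintro p ⟨q', hq', hp⟩ p' hp'
            rcases (hg q' hq').2 p' p hp hp' with rfl | ⟨q₁, hq₁, h₁⟩
            · exact ⟨q', hq', hp⟩
            · exact ⟨q₁, hlt q₁ q' hq₁.1 hq', h₁⟩)
          (a := a)
          (by
            convert (hf.2 _ (hQ.principal_mem_cfgs q)).1 using 1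
            ext c
            constructor
            · rintro (rfl | ⟨p, ⟨q', hq', hp⟩, rfl⟩)
              · exact ⟨q, hQ.le_refl q, hq⟩
              · exact ⟨q', hq'.1, by rw [(hg q' hq').1, hp]; rfl⟩
            · rintro ⟨q', hq', hc⟩
              by_cases hqq : q' = q
              · subst hqq
                exact .inl (Option.some.inj (hc.symm.trans hq))
              · rw [(hg q' ⟨hq', hqq⟩).1] at hc
                obtain ⟨p, hp, rfl⟩ := Option.map_eq_some_iff.1 hc
                exact .inr ⟨p, ⟨q', ⟨hq', hqq⟩, hp⟩, rfl⟩)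
        refine ⟨some p₀, congrArg some hp₀.symm, ?_⟩
        rintro p _ ⟨⟩ hp
        exact h p hp)
  have hfh : ∀ q, f q = (h q).map mx := fun q => (hh q).1
  have hdown : ∀ x ∈ Cfgs DQ, DnClosed (erLe P) (pimage h x) := by
    rintro x hx p ⟨q, hq, hp⟩ p' hp'
    rcases (hh q).2 p' p hp hp' with rfl | ⟨q', hq', h'⟩
    · exact ⟨q, hq, hp⟩
    · exact ⟨q', hx.1 q hq q' hq'.1, h'⟩
  refine ⟨h, ⟨fun q₁ q₂ hq => ?_, fun x hx => ⟨⟨hdown x hx, fun X hX hXf => ⟨hXf, ?_⟩⟩, ?_⟩⟩,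
    hfh, fun h' _ he q => ?_⟩
  · have := hf.1 q₁ q₂ hq
    rw [hfh, hfh] at this
    rcases this with ⟨h₁, h₂⟩ | ⟨b₁, b₂, h₁, h₂, hb⟩
    · exact .inl ⟨Option.map_eq_none_iff.1 h₁, Option.map_eq_none_iff.1 h₂⟩
    · obtain ⟨p₁, hp₁, rfl⟩ := Option.map_eq_some_iff.1 h₁
      obtain ⟨p₂, hp₂, rfl⟩ := Option.map_eq_some_iff.1 h₂
      exact .inr ⟨p₁, p₂, hp₁, hp₂, hb⟩
  · refine image_mem_of_subset hP hmx (hf.2 x hx).1 ?_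
    rintro _ ⟨p, ⟨p', hp', hle⟩, rfl⟩
    obtain ⟨q, hq, hqp⟩ := hdown x hx p' (hX hp') p hle
    exact ⟨q, hq, by rw [hfh, hqp]; rfl⟩
  · intro q₁ hq₁ q₂ hq₂ p₁ p₂ hp₁ hp₂ hp
    exact (hf.2 x hx).2 q₁ hq₁ q₂ hq₂ (mx p₁) (mx p₂) (by rw [hfh, hp₁]; rfl)
      (by rw [hfh, hp₂]; rfl) hp
  · rcases he q with ⟨h₁, h₂⟩ | ⟨b₁, b₂, h₁, h₂, hb⟩
    · rw [hfh] at h₁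
      exact .inl ⟨Option.map_eq_none_iff.1 h₂, Option.map_eq_none_iff.1 h₁⟩
    · rw [hfh] at h₁
      obtain ⟨p₁, hp₁, rfl⟩ := Option.map_eq_some_iff.1 h₁
      obtain ⟨p₂, hp₂, rfl⟩ := Option.map_eq_some_iff.1 h₂
      exact .inr ⟨p₂, p₁, hp₂, hp₁, heq.symm hb⟩
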